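/- Let D be a germ of two-dimensional singular holomorphic distribution at 0 ∈ ℂ^n (n ≥ 3), defined by a germ of holomorphic (n−2)-form ω with codim(sing(ω)) ≥ 2, and assume that the tangent sheaf T_D is locally free. Let X be a germ of holomorphic vector field at 0 with X(0) = 0, tangent to D (i.e. i_X ω = 0), and with linear rank at least 2. Then exactly one of the following holds: (1) there exist a germ of holomorphic vector field Y and a germ of holomorphic n-form Θ at 0 such that ω = i_X i_Y Θ, and this case occurs if and only if sing(X) ⊆ sing(D); (2) the germ of distribution D is regular (ω(0) ≠ 0), and in this case the linear rank of X equals exactly 2. -/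

import Mathlib

open Topology Filter Set
open scoped ENNReal Manifold

noncomputable section

/-- `ℂⁿ`. -/
abbrev Cn (n : ℕ) : Type := Fin n → ℂ

/-- Holomorphic `m`-forms on (open subsets of) `ℂⁿ`, as alternating-map valued functions. -/
abbrev Form (n m : ℕ) : Type := Cn n → AlternatingMap ℂ (Cn n) ℂ (Fin m)

/-- Vector fields on (open subsets of) `ℂⁿ`. -/
abbrev VF (n : ℕ) : Type := Cn n → Cn n

/-- A form is holomorphic on `U` if all its coefficient functions are. -/
def HolFormOn {n m : ℕ} (U : Set (Cn n)) (ω : Form n m) : Prop :=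
  ∀ v : Fin m → Cn n, AnalyticOnNhd ℂ (fun z => ω z v) U

/-- A form is holomorphic at (a neighborhood of) a point `c`. -/
def HolFormAt {n m : ℕ} (c : Cn n) (ω : Form n m) : Prop :=
  ∀ v : Fin m → Cn n, AnalyticAt ℂ (fun z => ω z v) c

/-- The zero locus (singular set) of a form. -/
def zeroLocus {n m : ℕ} (ω : Form n m) : Set (Cn n) := {z | ω z = 0}

/-- `V ⊆ ℂⁿ` has (complex) codimension at least `c`; via Hausdorff dimension
(a complex-analytic set of complex dimension `d` has Hausdorff dimension `2d`).
The empty set has codimension `≥ c` for every `c`. -/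
def CodimGE (n : ℕ) (V : Set (Cn n)) (c : ℕ) : Prop :=
  V = ∅ ∨ dimH V + 2 * (c : ℝ≥0∞) ≤ 2 * (n : ℝ≥0∞)

/-- The germ of `V` at `c` has codimension at least `k`. -/
def GermCodimGE (n : ℕ) (c : Cn n) (V : Set (Cn n)) (k : ℕ) : Prop :=
  ∃ U ∈ 𝓝 c, CodimGE n (V ∩ U) k

/-- `i_X (ω) = 0` at the point `z` : the form `ω` annihilates the vector `X z` at `z`. -/
def TangentAt {n m : ℕ} (ω : Form n m) (X : VF n) (z : Cn n) : Prop :=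
  ∀ (v : Fin m → Cn n) (i : Fin m), v i = X z → ω z v = 0

/-- `ω` is locally decomposable (as a wedge of holomorphic `1`-forms) at the points
of `U` where it does not vanish. -/
def LocallyDecomp {n m : ℕ} (U : Set (Cn n)) (ω : Form n m) : Prop :=
  ∀ z ∈ U, ω z ≠ 0 → ∃ W ∈ 𝓝 z, W ⊆ U ∧ ∃ η : Fin m → Cn n → (Cn n →ₗ[ℂ] ℂ),
    (∀ i (v : Cn n), AnalyticOnNhd ℂ (fun w => η i w v) W) ∧
    ∀ w ∈ W, ∀ v : Fin m → Cn n, ω w v = Matrix.det (Matrix.of fun i j => η i w (v j))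

/-- The rank of the derivative (linear part) of a vector field at a point. -/
def rkAt {n : ℕ} (X : VF n) (z : Cn n) : ℕ :=
  Module.finrank ℂ (LinearMap.range (fderiv ℂ X z).toLinearMap)

/-- The germ at `c` of the vector field `X` divides the germ of the `m`-form `ω`:
`ω = i_X Θ` for some germ of holomorphic `(m+1)`-form `Θ`. -/
def DividesAt {n m : ℕ} (X : VF n) (ω : Form n m) (c : Cn n) : Prop :=
  ∃ Θ : Form n (m + 1), HolFormAt c Θ ∧
    ∀ᶠ z in 𝓝 c, ∀ v : Fin m → Cn n, ω z v = Θ z (Fin.cons (X z) v)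

/-- The germ at `0` of an `m`-form defines a singular holomorphic distribution:
it is holomorphic, locally decomposable outside its zero set, and its zero set has
codimension at least two. -/
structure IsGermDist (n m : ℕ) (ω : Form n m) : Prop where
  hol : ∃ U ∈ 𝓝 (0 : Cn n), HolFormOn U ω ∧ LocallyDecomp U ω
  codim : GermCodimGE n 0 (zeroLocus ω) 2

/-- The tangent sheaf of the germ of two-dimensional distribution defined by the
`m`-form `ω` (`m = n - 2`) is locally free: `ω = i_Y i_Z Θ` for germs of vector fields
`Y, Z` and a germ of `n`-form `Θ`. -/
def GermLocFree2 (n m : ℕ) (ω : Form n m) : Prop :=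
  ∃ (Y Z : VF n) (Θ : Form n (m + 2)), AnalyticAt ℂ Y 0 ∧ AnalyticAt ℂ Z 0 ∧ HolFormAt 0 Θ ∧
    ∀ᶠ z in 𝓝 (0 : Cn n), ∀ v : Fin m → Cn n,
      ω z v = Θ z (Fin.cons (Y z) (Fin.cons (Z z) v))

/-- `ω = i_X i_Y Θ` near `0`, for some germ of vector field `Y` and germ of `n`-form `Θ`. -/
def DivPairAt {n m : ℕ} (X : VF n) (ω : Form n m) : Prop :=
  ∃ (Y : VF n) (Θ : Form n (m + 2)), AnalyticAt ℂ Y 0 ∧ HolFormAt 0 Θ ∧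
    ∀ᶠ z in 𝓝 (0 : Cn n), ∀ v : Fin m → Cn n,
      ω z v = Θ z (Fin.cons (X z) (Fin.cons (Y z) v))

/-- The tangent sheaf of the germ of `k`-dimensional distribution defined by the `m`-form
`ω` (`n = k + m`) is locally free: `ω = i_{X_1} ⋯ i_{X_k} Θ`. -/
def GermLocFreeK (n k m : ℕ) (h : n = k + m) (ω : Form n m) : Prop :=
  ∃ (Xs : Fin k → VF n) (Θ : Form n n), (∀ i, AnalyticAt ℂ (Xs i) 0) ∧ HolFormAt 0 Θ ∧
    ∀ᶠ z in 𝓝 (0 : Cn n), ∀ v : Fin m → Cn n,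
      ω z v = Θ z (fun i => Fin.append (fun a => Xs a z) v (Fin.cast h i))

/-- The germs at `c` of the vector fields `Xs` freely generate the germs of vector
fields tangent to the distribution defined by `ω` : every germ of tangent vector field
is a combination of the `Xs` with holomorphic coefficients, and the coefficients in such
combinations are unique (i.e. the `Xs` are independent over the local ring at `c`). -/
def FreeGensAt {n m : ℕ} (ω : Form n m) {k : ℕ} (Xs : Fin k → VF n) (c : Cn n) : Prop :=
  (∀ Z : VF n, AnalyticAt ℂ Z c → (∀ᶠ z in 𝓝 c, TangentAt ω Z z) →
      ∃ f : Fin k → Cn n → ℂ, (∀ i, AnalyticAt ℂ (f i) c) ∧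
        ∀ᶠ z in 𝓝 c, Z z = ∑ i, f i z • Xs i z) ∧
  (∀ f : Fin k → Cn n → ℂ, (∀ i, AnalyticAt ℂ (f i) c) →
      (∀ᶠ z in 𝓝 c, (∑ i, f i z • Xs i z) = 0) → ∀ i, ∀ᶠ z in 𝓝 c, f i z = 0)

/-- Polydiscs in `ℂⁿ`. -/
def IsPolydisc {n : ℕ} (U : Set (Cn n)) : Prop :=
  ∃ (c : Cn n) (r : Fin n → ℝ), (∀ i, 0 < r i) ∧ U = {z | ∀ i, dist (z i) (c i) < r i}

/-- The wedge product of a `1`-form with a `k`-form, as a function of `k+1` vectors. -/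
def wedge1 {n k : ℕ} (ω : Form n 1) (α : Form n k) (z : Cn n) (v : Fin (k + 1) → Cn n) : ℂ :=
  ∑ i : Fin (k + 1), (-1 : ℂ) ^ (i : ℕ) * ω z (fun _ => v i) * α z (fun j => v (i.succAbove j))

/-! ### Analytic subsets of open sets of `ℂᴺ`, irreducibility, components -/

/-- `V` is an analytic subset of `U`: locally (on `U`) it is the common zero set of
finitely many holomorphic functions. -/
def IsAnalyticIn {N : ℕ} (U V : Set (Cn N)) : Prop :=
  V ⊆ U ∧ ∀ p ∈ U, ∃ W ∈ 𝓝 p, ∃ (r : ℕ) (f : Fin r → Cn N → ℂ),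
    (∀ i, AnalyticOnNhd ℂ (f i) W) ∧ ∀ z ∈ W ∩ U, (z ∈ V ↔ ∀ i, f i z = 0)

/-- An irreducible analytic subset of `U`. -/
def IsIrredAnalyticIn {N : ℕ} (U V : Set (Cn N)) : Prop :=
  IsAnalyticIn U V ∧ V.Nonempty ∧
    ∀ V1 V2, IsAnalyticIn U V1 → IsAnalyticIn U V2 → V = V1 ∪ V2 → V = V1 ∨ V = V2

/-- `C` is an irreducible component of the analytic set `V ⊆ U` : a maximal irreducible
analytic subset of `U` contained in `V`. -/
def IsIrredComponentIn {N : ℕ} (U V C : Set (Cn N)) : Prop :=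
  IsIrredAnalyticIn U C ∧ C ⊆ V ∧ ∀ C', IsIrredAnalyticIn U C' → C ⊆ C' → C' ⊆ V → C' = C

/-! ### Distributions and foliations on `ℙⁿ`, in homogeneous coordinates -/

/-- A `k`-dimensional singular holomorphic distribution of degree `d` on `ℙⁿ`, given in
homogeneous coordinates by a homogeneous `(n-k)`-form `ω` on `ℂⁿ⁺¹` (with polynomial
coefficients of degree `d+1`) satisfying `i_R ω = 0`, locally decomposable outside its
singular set, whose singular set has codimension at least `2`. -/
structure ProjDist (n k : ℕ) where
  d : ℕ
  ω : Form (n + 1) (n - k)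
  hol : HolFormOn Set.univ ω
  homog : ∀ (t : ℂ) (z : Cn (n + 1)) (v : Fin (n - k) → Cn (n + 1)),
    ω (t • z) v = t ^ (d + 1) * ω z v
  radial : ∀ (z : Cn (n + 1)) (v : Fin (n - k) → Cn (n + 1)) (i : Fin (n - k)),
    v i = z → ω z v = 0
  decomp : LocallyDecomp Set.univ ω
  codim : CodimGE (n + 1) {z | z ≠ 0 ∧ ω z = 0} 2

/-- The singular set of a distribution on `ℙⁿ`, as a cone in `ℂⁿ⁺¹ \ {0}`. -/
def ProjDist.coneSing {n k : ℕ} (D : ProjDist n k) : Set (Cn (n + 1)) :=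
  {z | z ≠ 0 ∧ D.ω z = 0}

/-- A one-dimensional singular holomorphic foliation of degree `d` on `ℙⁿ`, given in
homogeneous coordinates by a homogeneous polynomial vector field on `ℂⁿ⁺¹`, whose
singular set (points where `V ∧ R = 0`) has codimension at least `2`. -/
structure ProjFol1 (n : ℕ) where
  d : ℕ
  V : VF (n + 1)
  hol : AnalyticOnNhd ℂ V Set.univ
  homog : ∀ (t : ℂ) (z : Cn (n + 1)), V (t • z) = t ^ d • V z
  codim : CodimGE (n + 1) {z | z ≠ 0 ∧ V z ∈ Submodule.span ℂ {z}} 2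

/-- The singular set of a one-dimensional foliation on `ℙⁿ`, as a cone in `ℂⁿ⁺¹ \ {0}`. -/
def ProjFol1.coneSing {n : ℕ} (G : ProjFol1 n) : Set (Cn (n + 1)) :=
  {z | z ≠ 0 ∧ G.V z ∈ Submodule.span ℂ {z}}

/-- The foliation `G` is tangent to the distribution `D` : `i_V ω = 0`. -/
def PTangent {n k : ℕ} (G : ProjFol1 n) (D : ProjDist n k) : Prop :=
  ∀ (z : Cn (n + 1)) (v : Fin (n - k) → Cn (n + 1)) (i : Fin (n - k)),
    v i = G.V z → D.ω z v = 0

/-- `G` locally divides the two-dimensional distribution `D` at the point of `ℙⁿ`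
corresponding to `q ∈ ℂⁿ⁺¹ \ {0}` : in homogeneous coordinates, `ω = i_V i_R Θ` near `q`
for some germ of holomorphic `(n-1)`-form `Θ` (equivalently, in an affine chart at `[q]`,
the defining vector field of `G` divides the defining form of `D`). -/
def PLocDividesAt {n : ℕ} (G : ProjFol1 n) (D : ProjDist n 2) (q : Cn (n + 1)) : Prop :=
  ∃ Θ : Form (n + 1) (n - 2 + 2), HolFormAt q Θ ∧
    ∀ᶠ z in 𝓝 q, ∀ v : Fin (n - 2) → Cn (n + 1),
      D.ω z v = Θ z (Fin.cons (G.V z) (Fin.cons z v))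

/-- The tangent sheaf of the two-dimensional distribution `D` on `ℙⁿ` is locally free:
near every point of `ℂⁿ⁺¹ \ {0}` one can write `ω = i_X i_Y i_R Θ`. -/
def PLocFreeAt {n : ℕ} (D : ProjDist n 2) (q : Cn (n + 1)) : Prop :=
  ∃ (X Y : VF (n + 1)) (Θ : Form (n + 1) (n - 2 + 3)),
    AnalyticAt ℂ X q ∧ AnalyticAt ℂ Y q ∧ HolFormAt q Θ ∧
    ∀ᶠ z in 𝓝 q, ∀ v : Fin (n - 2) → Cn (n + 1),
      D.ω z v = Θ z (Fin.cons (X z) (Fin.cons (Y z) (Fin.cons z v)))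

def PLocFree {n : ℕ} (D : ProjDist n 2) : Prop :=
  ∀ q : Cn (n + 1), q ≠ 0 → PLocFreeAt D q

/-- The linearization, at a singular point `q` (with `ℓ q = 1`), of the vector field
induced on the affine chart `{ℓ = 1}` of `ℙⁿ` by the homogeneous vector field `V`. -/
def projLin {n : ℕ} (V : VF n) (q : Cn n) (ℓ : Cn n →ₗ[ℂ] ℂ) : Cn n →ₗ[ℂ] Cn n :=
  (fderiv ℂ V q).toLinearMap - LinearMap.smulRight (ℓ ∘ₗ (fderiv ℂ V q).toLinearMap) q
    - ℓ (V q) • LinearMap.id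

/-- The linear rank of the one-dimensional foliation `G` on `ℙⁿ` is at least `r` :
at every singular point, the linearization of the vector field induced on an affine
chart has rank at least `r`. -/
def PLinRankGE {n : ℕ} (G : ProjFol1 n) (r : ℕ) : Prop :=
  ∀ q ∈ G.coneSing, ∃ ℓ : Cn (n + 1) →ₗ[ℂ] ℂ, ℓ q = 1 ∧
    r ≤ Module.finrank ℂ (Submodule.map (projLin G.V q ℓ) (LinearMap.ker ℓ))

/-- `T_D = T_G ⊕ T_H` : in homogeneous coordinates,
`ω = c ⋅ i_{V_G} i_{V_H} i_R (dx_0 ∧ ⋯ ∧ dx_n)` for a nonzero constant `c`. -/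
def SplitPair {n : ℕ} (hn : n + 1 = 3 + (n - 2)) (G H : ProjFol1 n) (D : ProjDist n 2) :
    Prop :=
  ∃ c : ℂ, c ≠ 0 ∧ ∀ (z : Cn (n + 1)) (v : Fin (n - 2) → Cn (n + 1)),
    D.ω z v = c * Matrix.det (Matrix.of fun i j =>
      Fin.append ![G.V z, H.V z, z] v (Fin.cast hn i) j)

/-- The tangent sheaf of the two-dimensional distribution `D` on `ℙⁿ` splits as a direct
sum of two line bundles: `ω = c ⋅ i_{X_1} i_{X_2} i_R (dx_0 ∧ ⋯ ∧ dx_n)` for homogeneous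
polynomial vector fields `X_1, X_2` on `ℂⁿ⁺¹`. -/
def PSplits {n : ℕ} (hn : n + 1 = 3 + (n - 2)) (D : ProjDist n 2) : Prop :=
  ∃ (X1 X2 : VF (n + 1)) (d1 d2 : ℕ) (c : ℂ), c ≠ 0 ∧
    AnalyticOnNhd ℂ X1 Set.univ ∧ AnalyticOnNhd ℂ X2 Set.univ ∧
    (∀ (t : ℂ) (z : Cn (n + 1)), X1 (t • z) = t ^ d1 • X1 z) ∧
    (∀ (t : ℂ) (z : Cn (n + 1)), X2 (t • z) = t ^ d2 • X2 z) ∧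
    ∀ (z : Cn (n + 1)) (v : Fin (n - 2) → Cn (n + 1)),
      D.ω z v = c * Matrix.det (Matrix.of fun i j =>
        Fin.append ![X1 z, X2 z, z] v (Fin.cast hn i) j)

/-- The coefficient of the exterior differential of a `1`-form: `dω(a,b)` at `z`. -/
def extd1 {N : ℕ} (ω : Form N 1) (z a b : Cn N) : ℂ :=
  fderiv ℂ (fun y => ω y ![b]) z a - fderiv ℂ (fun y => ω y ![a]) z b

/-- The Frobenius integrability condition `ω ∧ dω = 0` for a `1`-form. -/
def Integrable1 {N : ℕ} (ω : Form N 1) : Prop :=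
  ∀ z a b c : Cn N,
    ω z ![a] * extd1 ω z b c + ω z ![b] * extd1 ω z c a + ω z ![c] * extd1 ω z a b = 0

/-! ### Distributions and foliations on complex manifolds -/

section Manifold

variable {n k : ℕ} {M : Type*} [TopologicalSpace M] [ChartedSpace (Cn n) M]

/-- A `k`-dimensional singular holomorphic distribution on a complex `n`-manifold `M`:
around each point it is given, in the chart at that point, by a holomorphic `(n-k)`-form,
locally decomposable outside its zero set, with zero set of codimension at least 2;
on overlaps the local forms agree up to a nonvanishing holomorphic factor. -/
structure MDist (n k : ℕ) (M : Type*) [TopologicalSpace M] [ChartedSpace (Cn n) M] where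
  ω : M → Form n (n - k)
  dom : M → Set (Cn n)
  dom_open : ∀ p, IsOpen (dom p)
  dom_sub : ∀ p, dom p ⊆ (chartAt (Cn n) p).target
  dom_mem : ∀ p, chartAt (Cn n) p p ∈ dom p
  hol : ∀ p, HolFormOn (dom p) (ω p)
  decomp : ∀ p, LocallyDecomp (dom p) (ω p)
  codim : ∀ p, CodimGE n (zeroLocus (ω p) ∩ dom p) 2
  compat : ∀ p q : M, ∀ x : M, x ∈ (chartAt (Cn n) p).source → x ∈ (chartAt (Cn n) q).source →
    chartAt (Cn n) p x ∈ dom p → chartAt (Cn n) q x ∈ dom q →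
    ∃ W ∈ 𝓝 (chartAt (Cn n) p x), W ⊆ dom p ∧
      ∃ h : Cn n → ℂ, AnalyticOnNhd ℂ h W ∧ (∀ z ∈ W, h z ≠ 0) ∧
      ∀ z ∈ W, ∀ v : Fin (n - k) → Cn n,
        ω p z v = h z * ω q ((chartAt (Cn n) q) ((chartAt (Cn n) p).symm z))
          (fun i => fderiv ℂ (fun y => (chartAt (Cn n) q) ((chartAt (Cn n) p).symm y)) z (v i))

/-- The singular set of a distribution on a manifold. -/
def MDist.sing (D : MDist n k M) : Set M :=
  {x | D.ω x (chartAt (Cn n) x x) = 0}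

/-- A one-dimensional singular holomorphic foliation on a complex `n`-manifold `M`:
around each point it is given, in the chart at that point, by a holomorphic vector field
with singular set of codimension at least 2; on overlaps the local vector fields agree,
up to a nonvanishing holomorphic factor, under the differentials of the transition maps. -/
structure MFol1 (n : ℕ) (M : Type*) [TopologicalSpace M] [ChartedSpace (Cn n) M] where
  V : M → VF n
  dom : M → Set (Cn n)
  dom_open : ∀ p, IsOpen (dom p)
  dom_sub : ∀ p, dom p ⊆ (chartAt (Cn n) p).target
  dom_mem : ∀ p, chartAt (Cn n) p p ∈ dom p
  hol : ∀ p, AnalyticOnNhd ℂ (V p) (dom p)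
  codim : ∀ p, CodimGE n ({z ∈ dom p | V p z = 0}) 2
  compat : ∀ p q : M, ∀ x : M, x ∈ (chartAt (Cn n) p).source → x ∈ (chartAt (Cn n) q).source →
    chartAt (Cn n) p x ∈ dom p → chartAt (Cn n) q x ∈ dom q →
    ∃ W ∈ 𝓝 (chartAt (Cn n) p x), W ⊆ dom p ∧
      ∃ h : Cn n → ℂ, AnalyticOnNhd ℂ h W ∧ (∀ z ∈ W, h z ≠ 0) ∧
      ∀ z ∈ W,
        fderiv ℂ (fun y => (chartAt (Cn n) q) ((chartAt (Cn n) p).symm y)) z (V p z)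
          = h z • V q ((chartAt (Cn n) q) ((chartAt (Cn n) p).symm z))

/-- The singular set of a one-dimensional foliation on a manifold. -/
def MFol1.sing (G : MFol1 n M) : Set M :=
  {x | G.V x (chartAt (Cn n) x x) = 0}

/-- The foliation `G` is tangent to the distribution `D`. -/
def MTangent (G : MFol1 n M) (D : MDist n k M) : Prop :=
  ∀ p : M, ∀ z ∈ G.dom p ∩ D.dom p, TangentAt (D.ω p) (G.V p) z

/-- `G` locally divides `D` at `p` : in the chart at `p`, the germ of the defining vector
field of `G` divides the germ of the defining form of `D`. -/
def MLocDividesAt (G : MFol1 n M) (D : MDist n k M) (p : M) : Prop :=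
  DividesAt (G.V p) (D.ω p) (chartAt (Cn n) p p)

/-- The linear rank of `G` is at least `r`: at every singular point `p`, the rank of the
derivative at (the chart image of) `p` of the defining vector field is at least `r`. -/
def MLinRankGE (G : MFol1 n M) (r : ℕ) : Prop :=
  ∀ p ∈ MFol1.sing G, r ≤ rkAt (G.V p) (chartAt (Cn n) p p)

/-- The stalk of the tangent sheaf of `D` at `p` is a free module with `r` generators. -/
def MStalkFreeWith (D : MDist n k M) (p : M) (r : ℕ) : Prop :=
  ∃ Xs : Fin r → VF n, (∀ i, AnalyticAt ℂ (Xs i) (chartAt (Cn n) p p)) ∧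
    (∀ i, ∀ᶠ z in 𝓝 (chartAt (Cn n) p p), TangentAt (D.ω p) (Xs i) z) ∧
    FreeGensAt (D.ω p) Xs (chartAt (Cn n) p p)

/-- (a) The tangent sheaf of `D` is locally free of rank `k`: near every point there are
`k` holomorphic tangent vector fields which freely generate every stalk. -/
def MPropA (D : MDist n k M) : Prop :=
  ∀ p : M, ∃ U : Set (Cn n), IsOpen U ∧ chartAt (Cn n) p p ∈ U ∧ U ⊆ D.dom p ∧
    ∃ Xs : Fin k → VF n, (∀ i, AnalyticOnNhd ℂ (Xs i) U) ∧
      (∀ i, ∀ z ∈ U, TangentAt (D.ω p) (Xs i) z) ∧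
      ∀ z ∈ U, FreeGensAt (D.ω p) Xs z

/-- (b) Near every point, `T_D` is the direct sum of the tangent sheaves of `k`
one-dimensional foliations (defined by vector fields with singular set of codim `≥ 2`). -/
def MPropB (D : MDist n k M) : Prop :=
  ∀ p : M, ∃ U : Set (Cn n), IsOpen U ∧ chartAt (Cn n) p p ∈ U ∧ U ⊆ D.dom p ∧
    ∃ Xs : Fin k → VF n, (∀ i, AnalyticOnNhd ℂ (Xs i) U) ∧
      (∀ i, CodimGE n {z ∈ U | Xs i z = 0} 2) ∧
      (∀ i, ∀ z ∈ U, TangentAt (D.ω p) (Xs i) z) ∧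
      ∀ z ∈ U, FreeGensAt (D.ω p) Xs z

/-- (c) Near every point, a form `i_{X_1} ⋯ i_{X_k} Θ` defines `D`. -/
def MPropC (h : n = k + (n - k)) (D : MDist n k M) : Prop :=
  ∀ p : M, ∃ U : Set (Cn n), IsOpen U ∧ chartAt (Cn n) p p ∈ U ∧ U ⊆ D.dom p ∧
    ∃ (Xs : Fin k → VF n) (Θ : Form n n) (u : Cn n → ℂ),
      (∀ i, AnalyticOnNhd ℂ (Xs i) U) ∧ HolFormOn U Θ ∧
      AnalyticOnNhd ℂ u U ∧ (∀ z ∈ U, u z ≠ 0) ∧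
      ∀ z ∈ U, ∀ v : Fin (n - k) → Cn n,
        D.ω p z v = u z * Θ z (fun i => Fin.append (fun a => Xs a z) v (Fin.cast h i))

/-- (d) At every point, a form `i_{X_1} ⋯ i_{X_k} Θ` defines the germ of `D`. -/
def MPropD (h : n = k + (n - k)) (D : MDist n k M) : Prop :=
  ∀ p : M, ∃ (Xs : Fin k → VF n) (Θ : Form n n) (u : Cn n → ℂ),
    (∀ i, AnalyticAt ℂ (Xs i) (chartAt (Cn n) p p)) ∧ HolFormAt (chartAt (Cn n) p p) Θ ∧
    AnalyticAt ℂ u (chartAt (Cn n) p p) ∧ u (chartAt (Cn n) p p) ≠ 0 ∧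
    ∀ᶠ z in 𝓝 (chartAt (Cn n) p p), ∀ v : Fin (n - k) → Cn n,
      D.ω p z v = u z * Θ z (fun i => Fin.append (fun a => Xs a z) v (Fin.cast h i))

/-- (e) Every stalk of `T_D` is a free module with `k` generators. -/
def MPropE (D : MDist n k M) : Prop :=
  ∀ p : M, MStalkFreeWith D p k

/-- A subset `S` of the complex manifold `M` is analytic: it is closed and locally,
in charts, the common zero set of finitely many holomorphic functions. -/
def MIsAnalytic (n : ℕ) {M : Type*} [TopologicalSpace M] [ChartedSpace (Cn n) M] (S : Set M) : Prop :=
  IsClosed S ∧ ∀ p : M, ∃ W ∈ 𝓝 (chartAt (Cn n) p p), ∃ (r : ℕ) (f : Fin r → Cn n → ℂ),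
    (∀ i, AnalyticOnNhd ℂ (f i) W) ∧
    ∀ z ∈ W ∩ (chartAt (Cn n) p).target, ((chartAt (Cn n) p).symm z ∈ S ↔ ∀ i, f i z = 0)

/-- Irreducible analytic subsets of `M`. -/
def MIrredAnalytic (n : ℕ) {M : Type*} [TopologicalSpace M] [ChartedSpace (Cn n) M] (S : Set M) : Prop :=
  MIsAnalytic n S ∧ S.Nonempty ∧
    ∀ S1 S2 : Set M, MIsAnalytic n S1 → MIsAnalytic n S2 → S = S1 ∪ S2 → S = S1 ∨ S = S2

/-- `C` is an irreducible component of `V ⊆ M`. -/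
def MIrredComponentOf (n : ℕ) {M : Type*} [TopologicalSpace M] [ChartedSpace (Cn n) M] (V C : Set M) : Prop :=
  MIrredAnalytic n C ∧ C ⊆ V ∧ ∀ C', MIrredAnalytic n C' → C ⊆ C' → C' ⊆ V → C' = C

/-- The local dimension of `S ⊆ M` at `p` equals `d` (via Hausdorff dimension of chart
images on small neighborhoods). -/
def MLocDimEq (n : ℕ) {M : Type*} [TopologicalSpace M] [ChartedSpace (Cn n) M] (S : Set M) (p : M) (d : ℕ) : Prop :=
  ∀ᶠ U in (𝓝 p).smallSets,
    dimH (chartAt (Cn n) p '' (S ∩ U ∩ (chartAt (Cn n) p).source)) = ((2 * d : ℕ) : ℝ≥0∞)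

/-- The dimension of `S ⊆ M` equals `d`. -/
def MDimEq (n : ℕ) {M : Type*} [TopologicalSpace M] [ChartedSpace (Cn n) M] (S : Set M) (d : ℕ) : Prop :=
  (∀ p : M, ∀ᶠ U in (𝓝 p).smallSets,
    dimH (chartAt (Cn n) p '' (S ∩ U ∩ (chartAt (Cn n) p).source)) ≤ ((2 * d : ℕ) : ℝ≥0∞)) ∧
  ∃ p : M, MLocDimEq n S p d

end Manifold

end

/-- Composition with an analytic germ is analytic on spaces of continuous functions. -/
lemma aux_nemytskii {K E : Type*} [TopologicalSpace K] [CompactSpace K]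
    [NormedAddCommGroup E] [NormedSpace ℂ E] {P : E → ℂ} (hP : AnalyticAt ℂ P 0) :
    ∃ (Q : C(K, E) → C(K, ℂ)) (r : ℝ), 0 < r ∧ AnalyticOnNhd ℂ Q (Metric.ball 0 r) ∧
      ∀ f ∈ Metric.ball (0 : C(K, E)) r, ∀ k, Q f k = P (f k) := by
  obtain ⟨p, R, hp⟩ := hP
  let pm : ∀ n : ℕ, MultilinearMap ℂ (fun _ : Fin n => C(K, E)) C(K, ℂ) := fun n =>
    { toFun := fun f => ⟨fun k => p n (fun i => f i k),
        (p n).cont.comp (continuous_pi fun i => (f i).continuous)⟩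
      map_update_add' := by
        intro _ f i x y
        ext k
        have h : ∀ u : C(K, E), (fun j => (Function.update f i u) j k)
            = Function.update (fun j => f j k) i (u k) := by
          intro u
          funext j
          by_cases hj : j = i
          · subst hj; simp
          · simp [hj]
        simp only [ContinuousMap.coe_mk, ContinuousMap.add_apply]
        convert (p n).map_update_add (fun j => f j k) i (x k) (y k) using 2
        · convert h (x + y)
          rfl
        · congr 1; convert h x
        · congr 1; convert h y
      map_update_smul' := by
        intro _ f i c x
        ext k
        have h : ∀ u : C(K, E), (fun j => (Function.update f i u) j k)
            = Function.update (fun j => f j k) i (u k) := by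
          intro u
          funext j
          by_cases hj : j = i
          · subst hj; simp
          · simp [hj]
        simp only [ContinuousMap.coe_mk, ContinuousMap.smul_apply]
        convert (p n).map_update_smul (fun j => f j k) i c (x k) using 2
        · convert h (c • x)
          rfl
        · congr 1; convert h x }
  have hb : ∀ n (f : Fin n → C(K, E)), ‖pm n f‖ ≤ ‖p n‖ * ∏ i, ‖f i‖ := by
    intro n f
    rw [ContinuousMap.norm_le _ (by positivity)]
    intro k
    refine ((p n).le_opNorm _).trans ?_
    gcongr with i
    exact (f i).norm_coe_le_norm k
  let q : FormalMultilinearSeries ℂ C(K, E) C(K, ℂ) := fun n =>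
    (pm n).mkContinuous ‖p n‖ (hb n)
  have hq : ∀ n, ‖q n‖ ≤ ‖p n‖ := fun n =>
    MultilinearMap.mkContinuous_norm_le _ (norm_nonneg _) _
  have hrad : p.radius ≤ q.radius := by
    refine ENNReal.le_of_forall_nnreal_lt fun r hr => ?_
    obtain ⟨C, _, hC⟩ := p.norm_mul_pow_le_of_lt_radius hr
    refine q.le_radius_of_bound C fun n => le_trans ?_ (hC n)
    gcongr
    exact hq n
  have hq0 : 0 < q.radius := hp.r_pos.trans_le (hp.r_le.trans hrad)
  have hqs := q.hasFPowerSeriesOnBall hq0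
  obtain ⟨r, hr0, hrR⟩ := ENNReal.lt_iff_exists_nnreal_btwn.1 hp.r_pos
  have hr0' : 0 < r := by exact_mod_cast hr0
  have hsub : Metric.ball (0 : C(K, E)) r ⊆ Metric.eball 0 R := by
    intro f hf
    rw [Metric.mem_eball, edist_zero_right, enorm_eq_nnnorm]
    rw [mem_ball_zero_iff] at hf
    refine lt_trans ?_ hrR
    exact_mod_cast hf
  refine ⟨q.sum, r, hr0', ?_, ?_⟩
  · refine hqs.analyticOnNhd.mono (hsub.trans ?_)
    exact Metric.eball_subset_eball (hp.r_le.trans hrad)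
  · intro f hf k
    have h1 := hqs.hasSum (Metric.eball_subset_eball (hp.r_le.trans hrad) (hsub hf))
    have h2 := h1.mapL (ContinuousMap.evalCLM ℂ k)
    have hfk : f k ∈ Metric.eball (0 : E) R := by
      have := hsub hf
      rw [Metric.mem_eball, edist_zero_right, enorm_eq_nnnorm] at this ⊢
      refine lt_of_le_of_lt ?_ this
      exact_mod_cast f.norm_coe_le_norm k
    have h3 := hp.hasSum hfk
    rw [zero_add] at h2 h3
    exact h2.unique h3

lemma aux_finrank (m : ℕ) : Module.finrank ℝ (Cn m) = 2 * m := by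
  have := Module.finrank_mul_finrank ℝ ℂ (Cn m)
  simp at this
  simpa using this.symm

/-- A complex line through the origin missing a set of small Hausdorff dimension. -/
lemma aux_line {m : ℕ} {S : Set (Cn (m + 2))} (hS : dimH S < ((2 * (m + 1) : ℕ) : ℝ≥0∞)) :
    ∃ u : Cn (m + 1), ∀ t : ℂ, t ≠ 0 → t • (Fin.cons 1 u : Cn (m + 2)) ∉ S := by
  let f : Cn (m + 2) → Cn (m + 1) := fun z j => z j.succ / z 0
  have h1 : dimH (f '' (S ∩ {z | z 0 ≠ 0})) ≤ dimH (S ∩ {z | z 0 ≠ 0}) := by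
    refine dimH_image_le_of_locally_lipschitzOn fun x hx => ?_
    have : ContDiffAt ℂ 1 f x := by
      rw [contDiffAt_pi]
      intro j
      refine ContDiffAt.div ?_ ?_ hx.2
      · exact (contDiff_apply ℂ ℂ _).contDiffAt
      · exact (contDiff_apply ℂ ℂ _).contDiffAt
    obtain ⟨C, t, ht, hC⟩ := this.exists_lipschitzOnWith
    exact ⟨C, t, mem_nhdsWithin_of_mem_nhds ht, hC⟩
  have h2 : dimH (f '' (S ∩ {z | z 0 ≠ 0})) < Module.finrank ℝ (Cn (m + 1)) := by
    rw [aux_finrank]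
    exact (h1.trans (dimH_mono inter_subset_left)).trans_lt hS
  obtain ⟨u, hu⟩ := (dense_compl_of_dimH_lt_finrank h2).nonempty
  refine ⟨u, fun t ht hmem => hu ⟨_, ⟨hmem, by simpa using ht⟩, ?_⟩⟩
  funext j
  simp [f, ht]

/-- The translates of a complex line missing a set of small Hausdorff dimension are dense. -/
lemma aux_dense {m : ℕ} {S : Set (Cn (m + 2))} (hS : dimH S < ((2 * (m + 1) : ℕ) : ℝ≥0∞))
    (u : Cn (m + 1)) :
    Dense {z : Cn (m + 2) | ∀ t : ℂ, z + t • (Fin.cons 1 u : Cn (m + 2)) ∉ S} := by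
  let π : Cn (m + 2) →ₗ[ℂ] Cn (m + 1) :=
    { toFun := fun z j => z j.succ - z 0 * u j
      map_add' := by intro x y; funext j; simp; ring
      map_smul' := by intro c x; funext j; simp; ring }
  have hsurj : Function.Surjective π := by
    intro w
    refine ⟨Fin.cons 0 w, ?_⟩
    funext j
    simp [π]
  let πc : Cn (m + 2) →L[ℂ] Cn (m + 1) := LinearMap.toContinuousLinearMap π
  have hopen : IsOpenMap πc := πc.isOpenMap hsurj
  have h2 : dimH (πc '' S) < Module.finrank ℝ (Cn (m + 1)) := by
    rw [aux_finrank]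
    exact (πc.lipschitz.dimH_image_le S).trans_lt hS
  refine ((dense_compl_of_dimH_lt_finrank h2).preimage hopen).mono ?_
  intro z hz t hmem
  refine hz ⟨_, hmem, ?_⟩
  funext j
  simp [πc, π]
  ring

lemma aux_zero_of_dense {E F : Type*} [TopologicalSpace E] [TopologicalSpace F] [T1Space F] [Zero F]
    {T U : Set E} (hT : Dense T) (hU : IsOpen U) {f : E → F} (hf : ContinuousOn f U)
    (h : ∀ x ∈ U, x ∈ T → f x = 0) : ∀ x ∈ U, f x = 0 := by
  intro x hx
  by_contra hne
  have : ∀ᶠ y in 𝓝 x, f y ≠ 0 ∧ y ∈ U :=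
    ((hf.continuousAt (hU.mem_nhds hx)).eventually_ne hne).and (hU.mem_nhds hx)
  obtain ⟨y, hy, hyT⟩ := mem_closure_iff_nhds.1 (hT x) _ this
  exact hy.1 (h y hy.2 hyT)

/-- Averaging over the unit circle, as a continuous linear functional. -/
lemma aux_average : ∃ L : C(Circle, ℂ) →L[ℂ] ℂ, ∀ f, L f =
    (2 * Real.pi)⁻¹ • ∫ θ in (0 : ℝ)..2 * Real.pi, f (Circle.exp θ) := by
  have hint : ∀ f : C(Circle, ℂ), IntervalIntegrable (fun θ : ℝ => f (Circle.exp θ))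
      MeasureTheory.volume 0 (2 * Real.pi) := fun f =>
    (f.continuous.comp Circle.exp.continuous).intervalIntegrable _ _
  let L : C(Circle, ℂ) →ₗ[ℂ] ℂ :=
    { toFun := fun f => (2 * Real.pi)⁻¹ • ∫ θ in (0 : ℝ)..2 * Real.pi, f (Circle.exp θ)
      map_add' := by
        intro f g
        simp only [ContinuousMap.add_apply]
        rw [intervalIntegral.integral_add (hint f) (hint g), smul_add]
      map_smul' := by
        intro c f
        simp only [ContinuousMap.smul_apply, RingHom.id_apply]
        rw [intervalIntegral.integral_smul, smul_comm] }
  refine ⟨L.mkContinuous 1 fun f => ?_, fun f => rfl⟩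
  have h := intervalIntegral.norm_integral_le_of_norm_le_const (a := 0) (b := 2 * Real.pi)
    (f := fun θ : ℝ => f (Circle.exp θ)) (C := ‖f‖) (fun θ _ => f.norm_coe_le_norm _)
  have hpi := Real.pi_pos
  change ‖(2 * Real.pi)⁻¹ • ∫ θ in (0 : ℝ)..2 * Real.pi, f (Circle.exp θ)‖ ≤ 1 * ‖f‖
  rw [norm_smul, norm_inv, Real.norm_of_nonneg (by positivity), one_mul,
    inv_mul_le_iff₀ (by positivity)]
  rw [sub_zero, abs_of_pos (by positivity)] at h
  linarith

/-- Division of germs across a set of complex codimension at least two. -/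
lemma aux_division {m : ℕ} {ι : Type*} [Fintype ι] {P W : ι → Cn (m + 2) → ℂ}
    (hP : ∀ i, AnalyticAt ℂ (P i) 0) (hW : ∀ i, AnalyticAt ℂ (W i) 0)
    {S : Set (Cn (m + 2))} (hS : dimH S < ((2 * (m + 1) : ℕ) : ℝ≥0∞))
    (hWS : ∀ᶠ z in 𝓝 (0 : Cn (m + 2)), z ∉ S → ∃ i, W i z ≠ 0)
    (hPW : ∀ᶠ z in 𝓝 (0 : Cn (m + 2)), ∀ i j, P i z * W j z = P j z * W i z) :
    ∃ a : Cn (m + 2) → ℂ, AnalyticAt ℂ a 0 ∧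
      ∀ᶠ z in 𝓝 (0 : Cn (m + 2)), ∀ i, P i z = a z * W i z := by
  classical
  have hnem : ∀ {F : Cn (m + 2) → ℂ}, AnalyticAt ℂ F 0 →
      ∃ Q : C(Circle, Cn (m + 2)) → C(Circle, ℂ),
        ∀ᶠ f in 𝓝 (0 : C(Circle, Cn (m + 2))), AnalyticAt ℂ Q f ∧ ∀ k, Q f k = F (f k) := by
    intro F hF
    obtain ⟨Q, r, hr, hQ, hQF⟩ := aux_nemytskii (K := Circle) hF
    refine ⟨Q, ?_⟩
    filter_upwards [Metric.ball_mem_nhds _ hr] with f hf using ⟨hQ f hf, hQF f hf⟩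
  choose QP hQP using fun i => hnem (hP i)
  choose QW hQW using fun i => hnem (hW i)
  obtain ⟨r1, hr1, hQ⟩ := Metric.eventually_nhds_iff_ball.1
    ((eventually_all.2 hQP).and (eventually_all.2 hQW))
  obtain ⟨r2, hr2, hE⟩ := Metric.eventually_nhds_iff_ball.1
    (((eventually_all.2 fun i => (hP i).eventually_analyticAt).and
      (eventually_all.2 fun i => (hW i).eventually_analyticAt)).and (hWS.and hPW))
  obtain ⟨u, hu⟩ := aux_line hS
  have hdense := aux_dense hS u
  set v : Cn (m + 2) := Fin.cons 1 u with hv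
  set R := min r1 r2 with hR
  have hR0 : 0 < R := lt_min hr1 hr2
  replace hQ : ∀ f ∈ Metric.ball (0 : C(Circle, Cn (m + 2))) R, _ := fun f hf =>
    hQ f (Metric.ball_subset_ball (min_le_left _ _) hf)
  replace hE : ∀ x ∈ Metric.ball (0 : Cn (m + 2)) R, _ := fun x hx =>
    hE x (Metric.ball_subset_ball (min_le_right _ _) hx)
  set ρ : ℝ := R / (2 * (‖v‖ + 1)) with hρ
  have hρ0 : 0 < ρ := by positivity
  have hρv : ρ * ‖v‖ < R / 2 := by
    have : ρ * (‖v‖ + 1) = R / 2 := by rw [hρ]; field_simp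
    nlinarith
  -- the quotient
  obtain ⟨a0, ha0⟩ : ∃ a0 : Cn (m + 2) → ℂ, ∀ x ∈ Metric.ball (0 : Cn (m + 2)) R,
      ∀ i, W i x ≠ 0 → a0 x = P i x / W i x := by
    refine ⟨fun x => if h : ∃ i, W i x ≠ 0 then P h.choose x / W h.choose x else 0, ?_⟩
    intro x hx i hi
    have h : ∃ i, W i x ≠ 0 := ⟨i, hi⟩
    simp only [h, dif_pos]
    rw [div_eq_div_iff h.choose_spec hi]
    exact (hE x hx).2.2 _ _
  have ha0' : ∀ x ∈ Metric.ball (0 : Cn (m + 2)) R, x ∉ S → ∀ i, P i x = a0 x * W i x := by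
    intro x hx hxS i
    obtain ⟨j, hj⟩ := (hE x hx).2.1 hxS
    rw [ha0 x hx j hj, div_mul_eq_mul_div, eq_div_iff hj]
    exact (hE x hx).2.2 _ _
  -- the family of circles
  let γ0 : C(Circle, Cn (m + 2)) := ⟨fun s => ((ρ : ℂ) * s) • v, by fun_prop⟩
  let γl : Cn (m + 2) →L[ℂ] C(Circle, Cn (m + 2)) := LinearMap.mkContinuous
    { toFun := fun z => ContinuousMap.const Circle z
      map_add' := fun _ _ => rfl
      map_smul' := fun _ _ => rfl } 1 (by
        intro z
        rw [ContinuousMap.norm_le _ (by positivity)]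
        intro s
        rw [one_mul]
        exact le_refl ‖z‖)
  let γ : Cn (m + 2) → C(Circle, Cn (m + 2)) := fun z => γl z + γ0
  have hγ : ∀ z s, γ z s = z + ((ρ : ℂ) * s) • v := fun _ _ => rfl
  have hγan : ∀ z, AnalyticAt ℂ γ z := fun z => (γl.analyticAt z).add analyticAt_const
  have hbound : ∀ z : Cn (m + 2), ‖z‖ < R / 2 → ∀ t : ℂ, ‖t‖ ≤ ρ →
      z + t • v ∈ Metric.ball (0 : Cn (m + 2)) R := by
    intro z hz t ht
    rw [mem_ball_zero_iff]
    calc ‖z + t • v‖ ≤ ‖z‖ + ‖t‖ * ‖v‖ := (norm_add_le _ _).trans (by rw [norm_smul])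
      _ ≤ ‖z‖ + ρ * ‖v‖ := by gcongr
      _ < R := by linarith
  have hnρ : ∀ s : Circle, ‖(ρ : ℂ) * s‖ = ρ := by
    intro s
    rw [norm_mul, Circle.norm_coe, mul_one, Complex.norm_real, Real.norm_of_nonneg hρ0.le]
  have hγball : ∀ z : Cn (m + 2), ‖z‖ < R / 2 → γ z ∈ Metric.ball 0 R := by
    intro z hz
    rw [mem_ball_zero_iff, ContinuousMap.norm_lt_iff _ hR0]
    intro s
    exact mem_ball_zero_iff.1 (hbound z hz _ (hnρ s).le)
  have h0 : ‖(0 : Cn (m + 2))‖ < R / 2 := by simpa using hR0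
  let c : ι → C(Circle, ℂ) := fun i => star (QW i (γ 0))
  let D : Cn (m + 2) → C(Circle, ℂ) := fun z => ∑ i, c i * QW i (γ z)
  let N : Cn (m + 2) → C(Circle, ℂ) := fun z => ∑ i, c i * QP i (γ z)
  have hDan : AnalyticAt ℂ D 0 := by
    refine Finset.analyticAt_fun_sum _ fun i _ => analyticAt_const.mul ?_
    exact ((hQ _ (hγball 0 h0)).2 i).1.comp (hγan 0)
  have hNan : AnalyticAt ℂ N 0 := by
    refine Finset.analyticAt_fun_sum _ fun i _ => analyticAt_const.mul ?_
    exact ((hQ _ (hγball 0 h0)).1 i).1.comp (hγan 0)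
  have hD0 : IsUnit (D 0) := by
    rw [ContinuousMap.isUnit_iff_forall_ne_zero]
    intro s hs
    have hmem := hbound 0 h0 _ (hnρ s).le
    have hne : (ρ : ℂ) * s ≠ 0 := by
      rw [← norm_pos_iff, hnρ]; exact hρ0
    have hnS : (0 : Cn (m + 2)) + ((ρ : ℂ) * s) • v ∉ S := by
      rw [zero_add]; exact hu _ hne
    obtain ⟨i, hi⟩ := (hE _ hmem).2.1 hnS
    have e : D 0 s = ((∑ i, ‖W i (γ 0 s)‖ ^ 2 : ℝ) : ℂ) := by
      simp only [D, c, ContinuousMap.sum_apply, ContinuousMap.mul_apply, ContinuousMap.star_apply,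
        ((hQ _ (hγball 0 h0)).2 _).2, Complex.ofReal_sum]
      refine Finset.sum_congr rfl fun i _ => ?_
      rw [Complex.ofReal_pow]
      exact Complex.conj_mul' _
    rw [e] at hs
    have hs' := Complex.ofReal_eq_zero.1 hs
    rw [Finset.sum_eq_zero_iff_of_nonneg (fun _ _ => by positivity)] at hs'
    have := hs' i (Finset.mem_univ _)
    rw [hγ] at this
    exact hi (by simpa using this)
  obtain ⟨L, hL⟩ := aux_average
  have hinv : AnalyticAt ℂ (fun z => Ring.inverse (D z)) 0 := by
    obtain ⟨U, hU⟩ := hD0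
    have := analyticAt_inverse (𝕜 := ℂ) U
    rw [hU] at this
    exact this.comp hDan
  let a : Cn (m + 2) → ℂ := fun z => L (N z * Ring.inverse (D z))
  have haan : AnalyticAt ℂ a 0 := (L.analyticAt _).comp (hNan.mul hinv)
  have hkey : ∀ z : Cn (m + 2), ‖z‖ < R / 2 → IsUnit (D z) → (∀ t : ℂ, z + t • v ∉ S) →
      a z = a0 z := by
    intro z hz hu hzS
    have hq : ∀ s, (N z * Ring.inverse (D z)) s = a0 (z + ((ρ : ℂ) * s) • v) := by
      intro s
      have e1 : N z s = a0 (γ z s) * D z s := by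
        simp only [D, N, ContinuousMap.sum_apply, ContinuousMap.mul_apply,
          ((hQ _ (hγball z hz)).2 _).2, ((hQ _ (hγball z hz)).1 _).2, Finset.mul_sum]
        refine Finset.sum_congr rfl fun i _ => ?_
        rw [hγ, ha0' _ (hbound z hz _ (hnρ s).le) (hzS _) i]
        ring
      have e2 : D z s * Ring.inverse (D z) s = 1 := by
        have := congrArg (fun f : C(Circle, ℂ) => f s) (Ring.mul_inverse_cancel _ hu)
        simpa using this
      rw [ContinuousMap.mul_apply, e1, mul_assoc, e2, mul_one, hγ]
    have havg : a z = Real.circleAverage (fun t : ℂ => a0 (z + t • v)) 0 ρ := by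
      simp only [a, hL, Real.circleAverage, hq]
      simp [circleMap, Circle.coe_exp]
    have hdiff : ∀ t : ℂ, ‖t‖ ≤ ρ → DifferentiableAt ℂ (fun t : ℂ => a0 (z + t • v)) t := by
      intro t ht
      have hmem := hbound z hz t ht
      obtain ⟨i, hi⟩ := (hE _ hmem).2.1 (hzS t)
      have hWan := (hE _ hmem).1.2 i
      have hPan := (hE _ hmem).1.1 i
      have hlin : DifferentiableAt ℂ (fun t : ℂ => z + t • v) t := by fun_prop
      have hd : DifferentiableAt ℂ (fun t : ℂ => P i (z + t • v) / W i (z + t • v)) t := by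
        refine DifferentiableAt.div ?_ ?_ hi
        · exact DifferentiableAt.comp t (g := P i) hPan.differentiableAt hlin
        · exact DifferentiableAt.comp t (g := W i) hWan.differentiableAt hlin
      refine hd.congr_of_eventuallyEq ?_
      have h1 : ∀ᶠ x in 𝓝 (z + t • v), W i x ≠ 0 := hWan.continuousAt.eventually_ne hi
      have h2 : ∀ᶠ x in 𝓝 (z + t • v), x ∈ Metric.ball (0 : Cn (m + 2)) R :=
        Metric.isOpen_ball.mem_nhds hmem
      filter_upwards [hlin.continuousAt.eventually (h1.and h2)] with t' ht'
      exact ha0 _ ht'.2 i ht'.1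
    rw [havg, circleAverage_of_differentiable_on_off_countable countable_empty]
    · simp
    · intro t ht
      rw [abs_of_pos hρ0, mem_closedBall_zero_iff] at ht
      exact (hdiff t ht).continuousAt.continuousWithinAt
    · intro t ht
      rw [abs_of_pos hρ0] at ht
      exact hdiff t (mem_ball_zero_iff.1 ht.1).le
  -- conclusion by density
  have hunit : ∀ᶠ z in 𝓝 (0 : Cn (m + 2)), IsUnit (D z) :=
    hDan.continuousAt.eventually (Units.isOpen.mem_nhds hD0)
  obtain ⟨r3, hr3, hfin⟩ := Metric.eventually_nhds_iff_ball.1 (hunit.and haan.eventually_analyticAt)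
  refine ⟨a, haan, ?_⟩
  have hsmall : 0 < min r3 (R / 2) := lt_min hr3 (by positivity)
  filter_upwards [Metric.ball_mem_nhds _ hsmall] with z hz i
  have hzmem : ∀ x ∈ Metric.ball (0 : Cn (m + 2)) (min r3 (R / 2)),
      x ∈ Metric.ball (0 : Cn (m + 2)) r3 ∧ ‖x‖ < R / 2 ∧ x ∈ Metric.ball (0 : Cn (m + 2)) R := by
    intro x hx
    rw [mem_ball_zero_iff, lt_min_iff] at hx
    exact ⟨mem_ball_zero_iff.2 hx.1, hx.2, mem_ball_zero_iff.2 (by linarith)⟩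
  have hcont : ContinuousOn (fun z => P i z - a z * W i z)
      (Metric.ball (0 : Cn (m + 2)) (min r3 (R / 2))) := by
    intro x hx
    obtain ⟨h1, _, h3⟩ := hzmem x hx
    exact (((hE x h3).1.1 i).continuousAt.sub ((hfin x h1).2.continuousAt.mul
      ((hE x h3).1.2 i).continuousAt)).continuousWithinAt
  have hzero := aux_zero_of_dense hdense Metric.isOpen_ball hcont ?_ z hz
  · exact sub_eq_zero.1 hzero
  · intro x hx hxT
    obtain ⟨h1, h2, h3⟩ := hzmem x hx
    have hxS : x ∉ S := by simpa using hxT 0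
    rw [hkey x h2 (hfin x h1).1 hxT, ← ha0' x h3 hxS i, sub_self]

lemma aux_snoc {N k : ℕ} {Y Z x : Cn N} {v : Fin k → Cn N}
    (h : LinearIndependent ℂ (Fin.snoc (Fin.cons Y (Fin.cons Z v) : Fin (k + 2) → Cn N) x :
      Fin (k + 3) → Cn N)) :
    LinearIndependent ℂ (Fin.cons Y (Fin.cons Z (Fin.snoc v x : Fin (k + 1) → Cn N)) :
      Fin (k + 1 + 2) → Cn N) := by
  rw [Fin.cons_snoc_eq_snoc_cons, Fin.cons_snoc_eq_snoc_cons]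
  exact h

lemma aux_extend {N k : ℕ} {Y Z : Cn N} {v : Fin k → Cn N}
    (h : LinearIndependent ℂ (Fin.cons Y (Fin.cons Z v) : Fin (k + 2) → Cn N)) :
    ∀ d : ℕ, k + d + 2 ≤ N → ∃ w : Fin (k + d) → Cn N,
      LinearIndependent ℂ (Fin.cons Y (Fin.cons Z w) : Fin (k + d + 2) → Cn N) ∧
      ∀ i, w (Fin.castAdd d i) = v i := by
  intro d
  induction d with
  | zero => exact fun _ => ⟨v, h, fun i => rfl⟩
  | succ d ih =>
    intro hd
    obtain ⟨w, hw, hwv⟩ := ih (by omega)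
    obtain ⟨x, hx⟩ := exists_linearIndependent_snoc_of_lt_finrank hw
      (by rw [Module.finrank_fin_fun]; omega)
    refine ⟨(Fin.snoc w x : Fin (k + d + 1) → Cn N), aux_snoc hx, fun i => ?_⟩
    rw [← hwv i]
    exact Fin.snoc_castSucc (α := fun _ => Cn N) x w (Fin.castAdd d i)

lemma aux_det_ne {m : ℕ} {w : Fin (m + 2) → Cn (m + 2)} (h : LinearIndependent ℂ w) :
    (Pi.basisFun ℂ (Fin (m + 2))).det w ≠ 0 := by
  have := (Module.Basis.is_basis_iff_det (Pi.basisFun ℂ (Fin (m + 2)))).1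
    ⟨h, h.span_eq_top_of_card_eq_finrank (by simp)⟩
  exact this.ne_zero

lemma aux_pair_of_cons {N k : ℕ} {Y Z : Cn N} {v : Fin k → Cn N}
    (h : LinearIndependent ℂ (Fin.cons Y (Fin.cons Z v) : Fin (k + 2) → Cn N)) :
    LinearIndependent ℂ ![Y, Z] := by
  have h2 := h.comp (![0, 1] : Fin 2 → Fin (k + 2)) (by
    intro i j hij
    fin_cases i <;> fin_cases j <;> simp_all)
  convert h2 using 1
  funext i
  fin_cases i
  · rfl
  · rfl

lemma aux_complete2 {m : ℕ} {Y Z : Cn (m + 2)} (h : LinearIndependent ℂ ![Y, Z]) :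
    ∃ v : Fin m → Cn (m + 2),
      (Pi.basisFun ℂ (Fin (m + 2))).det (Fin.cons Y (Fin.cons Z v)) ≠ 0 := by
  obtain ⟨w, hw, -⟩ := aux_extend (k := 0) (v := ![]) h m (by omega)
  have : ∀ j (hj : j = m) (w : Fin j → Cn (m + 2)), LinearIndependent ℂ
      (Fin.cons Y (Fin.cons Z w) : Fin (j + 2) → Cn (m + 2)) →
      ∃ w' : Fin m → Cn (m + 2), LinearIndependent ℂ
        (Fin.cons Y (Fin.cons Z w') : Fin (m + 2) → Cn (m + 2)) := by
    rintro j rfl w hw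
    exact ⟨w, hw⟩
  obtain ⟨w', hw'⟩ := this _ (by omega) w hw
  exact ⟨w', aux_det_ne hw'⟩

lemma aux_mem_span {m : ℕ} (hm : 1 ≤ m) {Y Z X : Cn (m + 2)} (h : LinearIndependent ℂ ![Y, Z])
    (hX : ∀ (v : Fin m → Cn (m + 2)) (i : Fin m), v i = X →
      (Pi.basisFun ℂ (Fin (m + 2))).det (Fin.cons Y (Fin.cons Z v)) = 0) :
    ∃ α β : ℂ, X = α • Y + β • Z := by
  by_contra hne
  have hns : X ∉ Submodule.span ℂ (Set.range ![Y, Z]) := by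
    intro hmem
    rw [Matrix.range_cons, Matrix.range_cons, Matrix.range_empty, union_empty,
      singleton_union, Submodule.mem_span_pair] at hmem
    obtain ⟨α, β, e⟩ := hmem
    exact hne ⟨α, β, e.symm⟩
  have h3 := aux_snoc (k := 0) (v := ![]) (x := X) (Y := Y) (Z := Z)
    (linearIndependent_finSnoc.2 ⟨h, hns⟩)
  obtain ⟨d, rfl⟩ : ∃ d, m = 1 + d := ⟨m - 1, by omega⟩
  obtain ⟨w, hw, hwv⟩ := aux_extend h3 d (by omega)
  have hwv0 := hwv 0
  have e : ∀ j (hj : 0 + 1 + d = j) (w : Fin (0 + 1 + d) → Cn (1 + d + 2)),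
      LinearIndependent ℂ (Fin.cons Y (Fin.cons Z w) : Fin (0 + 1 + d + 2) → Cn (1 + d + 2)) →
      w (Fin.castAdd d 0) = X → ∃ (w' : Fin j → Cn (1 + d + 2)) (i : Fin j), w' i = X ∧
      LinearIndependent ℂ (Fin.cons Y (Fin.cons Z w') : Fin (j + 2) → Cn (1 + d + 2)) := by
    rintro j rfl w hw hwX
    exact ⟨w, _, hwX, hw⟩
  obtain ⟨w', i, hi, hw'⟩ := e (1 + d) (by omega) w hw hwv0
  exact aux_det_ne hw' (hX w' i hi)

lemma aux_minor_ne {N : ℕ} {Y Z : Cn N} (h : LinearIndependent ℂ ![Y, Z]) :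
    ∃ p : Fin N × Fin N, Y p.1 * Z p.2 - Y p.2 * Z p.1 ≠ 0 := by
  rw [LinearIndependent.pair_iff] at h
  by_contra! hall
  by_cases hY : ∃ k, Y k ≠ 0
  · obtain ⟨k, hk⟩ := hY
    refine hk ?_
    have := (h (Z k) (-Y k) ?_).2
    · simpa using this
    · funext j
      have := hall (j, k)
      simp only [Pi.add_apply, Pi.smul_apply, smul_eq_mul, Pi.zero_apply]
      linear_combination this
  · push Not at hY
    have := (h 1 0 (by funext j; simp [hY j])).1
    exact one_ne_zero this

lemma aux_minor_eq {N : ℕ} {Y Z : Cn N} (h : ¬ LinearIndependent ℂ ![Y, Z])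
    (p : Fin N × Fin N) : Y p.1 * Z p.2 - Y p.2 * Z p.1 = 0 := by
  rw [LinearIndependent.pair_iff] at h
  push Not at h
  obtain ⟨s, t, e, hst⟩ := h
  have e1 := congrFun e p.1
  have e2 := congrFun e p.2
  simp only [Pi.add_apply, Pi.smul_apply, smul_eq_mul, Pi.zero_apply] at e1 e2
  by_cases hs : s = 0
  · have ht := hst hs
    refine (mul_eq_zero.1 (?_ : t * _ = 0)).resolve_left ht
    linear_combination Y p.1 * e2 - Y p.2 * e1
  · refine (mul_eq_zero.1 (?_ : s * _ = 0)).resolve_left hs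
    linear_combination Z p.2 * e1 - Z p.1 * e2

/-- The vector field `X` is a combination of the generators `Y, Z`. -/
lemma aux_main {m : ℕ} (hm : 1 ≤ m) {X Y Z : Cn (m + 2) → Cn (m + 2)} {h : Cn (m + 2) → ℂ}
    (hX : AnalyticAt ℂ X 0) (hY : AnalyticAt ℂ Y 0) (hZ : AnalyticAt ℂ Z 0)
    (hh : AnalyticAt ℂ h 0)
    {S : Set (Cn (m + 2))} (hS : dimH S < ((2 * (m + 1) : ℕ) : ℝ≥0∞))
    (hne : ∀ᶠ z in 𝓝 (0 : Cn (m + 2)), z ∉ S → ∃ v : Fin m → Cn (m + 2),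
      h z * (Pi.basisFun ℂ (Fin (m + 2))).det (Fin.cons (Y z) (Fin.cons (Z z) v)) ≠ 0)
    (htan : ∀ᶠ z in 𝓝 (0 : Cn (m + 2)), ∀ (v : Fin m → Cn (m + 2)) (i : Fin m), v i = X z →
      h z * (Pi.basisFun ℂ (Fin (m + 2))).det (Fin.cons (Y z) (Fin.cons (Z z) v)) = 0) :
    h 0 ≠ 0 ∧ ∃ a b : Cn (m + 2) → ℂ, AnalyticAt ℂ a 0 ∧ AnalyticAt ℂ b 0 ∧
      ∀ᶠ z in 𝓝 (0 : Cn (m + 2)), X z = a z • Y z + b z • Z z := by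
  have hh0 : h 0 ≠ 0 := by
    obtain ⟨g, -, hg⟩ := aux_division (ι := Unit) (P := fun _ _ => 1) (W := fun _ => h)
      (fun _ => analyticAt_const) (fun _ => hh) hS (by
        filter_upwards [hne] with z hz hzS
        obtain ⟨v, hv⟩ := hz hzS
        exact ⟨(), left_ne_zero_of_mul hv⟩) (by simp)
    have := hg.self_of_nhds ()
    exact right_ne_zero_of_mul (this ▸ one_ne_zero)
  refine ⟨hh0, ?_⟩
  have hLI : ∀ᶠ z in 𝓝 (0 : Cn (m + 2)), z ∉ S → LinearIndependent ℂ ![Y z, Z z] := by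
    filter_upwards [hne] with z hz hzS
    obtain ⟨v, hv⟩ := hz hzS
    by_contra hc
    refine right_ne_zero_of_mul hv ?_
    exact AlternatingMap.map_linearDependent _ _ fun hl => hc (aux_pair_of_cons hl)
  have hspan : ∀ᶠ z in 𝓝 (0 : Cn (m + 2)), LinearIndependent ℂ ![Y z, Z z] →
      ∃ α β : ℂ, X z = α • Y z + β • Z z := by
    filter_upwards [htan, hh.continuousAt.eventually_ne hh0] with z hz hhz hl
    exact aux_mem_span hm hl fun v i hi => (mul_eq_zero.1 (hz v i hi)).resolve_left hhz
  have hc : ∀ {F : Cn (m + 2) → Cn (m + 2)}, AnalyticAt ℂ F 0 → ∀ i,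
      AnalyticAt ℂ (fun z => F z i) 0 := by
    intro F hF i
    exact ((ContinuousLinearMap.proj (R := ℂ) (φ := fun _ : Fin (m + 2) => ℂ) i).analyticAt _).comp
      hF
  have hmin : ∀ {F G : Cn (m + 2) → Cn (m + 2)}, AnalyticAt ℂ F 0 → AnalyticAt ℂ G 0 →
      ∀ p : Fin (m + 2) × Fin (m + 2),
        AnalyticAt ℂ (fun z => F z p.1 * G z p.2 - F z p.2 * G z p.1) 0 := by
    intro F G hF hG p
    exact ((hc hF _).mul (hc hG _)).sub ((hc hF _).mul (hc hG _))
  have hWS : ∀ᶠ z in 𝓝 (0 : Cn (m + 2)), z ∉ S → ∃ p : Fin (m + 2) × Fin (m + 2),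
      Y z p.1 * Z z p.2 - Y z p.2 * Z z p.1 ≠ 0 := by
    filter_upwards [hLI] with z hz hzS using aux_minor_ne (hz hzS)
  obtain ⟨a, ha, haW⟩ := aux_division (hmin hX hZ) (hmin hY hZ) hS hWS (by
    filter_upwards [hspan] with z hz p q
    by_cases hl : LinearIndependent ℂ ![Y z, Z z]
    · obtain ⟨α, β, e⟩ := hz hl
      simp only [e, Pi.add_apply, Pi.smul_apply, smul_eq_mul]
      ring
    · simp only [aux_minor_eq hl, mul_zero])
  obtain ⟨b, hb, hbW⟩ := aux_division (hmin hY hX) (hmin hY hZ) hS hWS (by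
    filter_upwards [hspan] with z hz p q
    by_cases hl : LinearIndependent ℂ ![Y z, Z z]
    · obtain ⟨α, β, e⟩ := hz hl
      simp only [e, Pi.add_apply, Pi.smul_apply, smul_eq_mul]
      ring
    · simp only [aux_minor_eq hl, mul_zero])
  refine ⟨a, b, ha, hb, ?_⟩
  have hT : Dense Sᶜ := by
    refine dense_compl_of_dimH_lt_finrank (hS.trans_le ?_)
    rw [aux_finrank]
    exact_mod_cast (by omega)
  have hcont : AnalyticAt ℂ (fun z => X z - (a z • Y z + b z • Z z)) 0 :=
    hX.sub ((ha.smul hY).add (hb.smul hZ))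
  obtain ⟨r, hr, hball⟩ := Metric.eventually_nhds_iff_ball.1
    (hcont.eventually_analyticAt.and (hLI.and (hspan.and (haW.and hbW))))
  filter_upwards [Metric.ball_mem_nhds _ hr] with z hz
  refine sub_eq_zero.1 (aux_zero_of_dense hT Metric.isOpen_ball
    (f := fun z => X z - (a z • Y z + b z • Z z))
    (fun x hx => (hball x hx).1.continuousAt.continuousWithinAt) ?_ z hz)
  intro x hx hxS
  obtain ⟨-, h1, h2, h3, h4⟩ := hball x hx
  obtain ⟨α, β, e⟩ := h2 (h1 hxS)
  obtain ⟨p, hp⟩ := aux_minor_ne (h1 hxS)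
  have e1 : α = a x := by
    refine mul_right_cancel₀ hp ?_
    rw [← h3 p]
    simp only [e, Pi.add_apply, Pi.smul_apply, smul_eq_mul]
    ring
  have e2 : β = b x := by
    refine mul_right_cancel₀ hp ?_
    rw [← h4 p]
    simp only [e, Pi.add_apply, Pi.smul_apply, smul_eq_mul]
    ring
  change X x - (a x • Y x + b x • Z x) = 0
  rw [← e1, ← e2, e, sub_self]

/-- If both coefficients vanish at the origin, then the generators are independent there and the
rank of the linear part is two. -/
lemma aux_rank {N : ℕ} {X Y Z : Cn N → Cn N} {a b : Cn N → ℂ}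
    (hY : AnalyticAt ℂ Y 0) (hZ : AnalyticAt ℂ Z 0) (ha : AnalyticAt ℂ a 0)
    (hb : AnalyticAt ℂ b 0) (hX : ∀ᶠ z in 𝓝 (0 : Cn N), X z = a z • Y z + b z • Z z)
    (ha0 : a 0 = 0) (hb0 : b 0 = 0)
    (hrk : 2 ≤ Module.finrank ℂ (LinearMap.range (fderiv ℂ X 0).toLinearMap)) :
    LinearIndependent ℂ ![Y 0, Z 0] ∧
      Module.finrank ℂ (LinearMap.range (fderiv ℂ X 0).toLinearMap) = 2 := by
  have hd : fderiv ℂ X 0 = (fderiv ℂ a 0).smulRight (Y 0) + (fderiv ℂ b 0).smulRight (Z 0) := by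
    have h1 := (ha.differentiableAt.hasFDerivAt.smul hY.differentiableAt.hasFDerivAt).add
      (hb.differentiableAt.hasFDerivAt.smul hZ.differentiableAt.hasFDerivAt)
    rw [ha0, hb0, zero_smul, zero_smul, zero_add, zero_add] at h1
    exact (h1.congr_of_eventuallyEq hX).fderiv
  have hle : LinearMap.range (fderiv ℂ X 0).toLinearMap ≤
      Submodule.span ℂ (Set.range ![Y 0, Z 0]) := by
    rintro _ ⟨w, rfl⟩
    rw [hd, Matrix.range_cons, Matrix.range_cons, Matrix.range_empty, union_empty,
      singleton_union, Submodule.mem_span_pair]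
    exact ⟨fderiv ℂ a 0 w, fderiv ℂ b 0 w, rfl⟩
  have hfr := Submodule.finrank_mono hle
  have h2 : (Set.range ![Y 0, Z 0]).finrank ℂ ≤ Fintype.card (Fin 2) :=
    finrank_range_le_card _
  rw [Fintype.card_fin] at h2
  have h2' : Module.finrank ℂ (Submodule.span ℂ (Set.range ![Y 0, Z 0])) ≤ 2 := h2
  refine ⟨?_, by omega⟩
  rw [linearIndependent_iff_card_eq_finrank_span, Fintype.card_fin]
  change 2 = Module.finrank ℂ (Submodule.span ℂ (Set.range ![Y 0, Z 0]))
  omega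

lemma aux_alt_comb {N k : ℕ} (f : AlternatingMap ℂ (Cn N) ℂ (Fin (k + 2))) (α β : ℂ)
    (A B : Cn N) (v : Fin k → Cn N) :
    f (Fin.cons (α • A + β • B) (Fin.cons B v)) = α * f (Fin.cons A (Fin.cons B v)) := by
  have h0 : f (Fin.cons B (Fin.cons B v)) = 0 :=
    f.map_eq_zero_of_eq _ (i := 0) (j := 1) rfl (by simp)
  have h1 := f.toMultilinearMap.cons_add (Fin.cons B v) (α • A) (β • B)
  have h2 := f.toMultilinearMap.cons_smul (Fin.cons B v) α A
  have h3 := f.toMultilinearMap.cons_smul (Fin.cons B v) β B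
  simp only [AlternatingMap.coe_multilinearMap, smul_eq_mul] at h1 h2 h3
  rw [h1, h2, h3, h0, mul_zero, add_zero]

lemma aux_alt_swap {N k : ℕ} (f : AlternatingMap ℂ (Cn N) ℂ (Fin (k + 2)))
    (A B : Cn N) (v : Fin k → Cn N) :
    f (Fin.cons A (Fin.cons B v)) = - f (Fin.cons B (Fin.cons A v)) := by
  have h := f.map_swap (Fin.cons B (Fin.cons A v)) (i := 0) (j := 1) (by simp)
  rw [← h]
  congr 1
  funext i
  refine Fin.cases ?_ (fun i => Fin.cases ?_ (fun i => ?_) i) i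
  · simp
  · simp
  · have e1 : Equiv.swap (0 : Fin (k + 2)) 1 i.succ.succ = i.succ.succ :=
      Equiv.swap_apply_of_ne_of_ne (by simp [Fin.ext_iff]) (by simp [Fin.ext_iff])
    simp only [Function.comp_apply, e1, Fin.cons_succ]

/-- Theorem A: Let `D` be a germ of two-dimensional singular holomorphic
distribution at `0 ∈ ℂⁿ` (`n ≥ 3`), defined by a germ of holomorphic `(n-2)`-form `ω`
with `codim sing(ω) ≥ 2`, with locally free tangent sheaf. Let `X` be a germ of
holomorphic vector field with `X 0 = 0`, tangent to `D`, of linear rank at least `2`.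
Then exactly one of: (1) `ω = i_X i_Y Θ` for some germs `Y`, `Θ` — which happens iff
`sing X ⊆ sing D`; (2) `D` is regular (`ω 0 ≠ 0`), in which case the linear rank of `X`
is exactly `2`. -/
theorem statement_0 (n m : ℕ) (hn : 3 ≤ n) (hm : n = m + 2)
    (ω : Form n m) (hdist : IsGermDist n m ω) (hfree : GermLocFree2 n m ω)
    (X : VF n) (hXhol : AnalyticAt ℂ X 0) (hX0 : X 0 = 0)
    (htan : ∀ᶠ z in 𝓝 (0 : Cn n), TangentAt ω X z)
    (hrk : 2 ≤ rkAt X 0) :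
    (DivPairAt X ω ∨ ω 0 ≠ 0) ∧ ¬(DivPairAt X ω ∧ ω 0 ≠ 0) ∧
    (DivPairAt X ω ↔ ∃ U ∈ 𝓝 (0 : Cn n), ∀ z ∈ U, X z = 0 → ω z = 0) ∧
    (ω 0 ≠ 0 → rkAt X 0 = 2) := by
  subst hm
  have hm1 : 1 ≤ m := by omega
  obtain ⟨Y, Z, Θ, hY, hZ, hΘ, hω⟩ := hfree
  set e := Pi.basisFun ℂ (Fin (m + 2)) with he
  let h : Cn (m + 2) → ℂ := fun z => Θ z e
  have hΘe : ∀ z v, Θ z v = h z * e.det v := by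
    intro z v
    have := congrArg (fun f => f v) ((Θ z).eq_smul_basis_det e)
    simpa using this
  obtain ⟨U, hU, hcod⟩ := hdist.codim
  have hS : dimH (zeroLocus ω ∩ U) < ((2 * (m + 1) : ℕ) : ℝ≥0∞) := by
    rcases hcod with h0 | hle
    · rw [h0, dimH_empty]
      exact_mod_cast (by omega : 0 < 2 * (m + 1))
    · have hfin : dimH (zeroLocus ω ∩ U) ≠ ⊤ := by
        intro htop
        rw [htop, top_add, top_le_iff] at hle
        exact ENNReal.mul_ne_top (by simp) (by simp) hle
      lift dimH (zeroLocus ω ∩ U) to NNReal using hfin with d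
      have h1 : d + 2 * ((2 : ℕ) : NNReal) ≤ 2 * ((m + 2 : ℕ) : NNReal) := by exact_mod_cast hle
      have h2 : d < ((2 * (m + 1) : ℕ) : NNReal) := by
        have h1' : (d : ℝ) + 2 * ((2 : ℕ) : ℝ) ≤ 2 * ((m + 2 : ℕ) : ℝ) := by exact_mod_cast h1
        have : (d : ℝ) < ((2 * (m + 1) : ℕ) : ℝ) := by
          push_cast at h1' ⊢
          linarith
        exact_mod_cast this
      exact_mod_cast h2
  obtain ⟨hh0, a, b, ha, hb, hX⟩ := aux_main hm1 hXhol hY hZ (h := h) (hΘ _) hS (by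
      filter_upwards [hω, hU] with z hz hzU hzS
      by_contra! hall
      refine hzS ⟨?_, hzU⟩
      ext v
      rw [hz v, hΘe]
      exact hall v) (by
      filter_upwards [hω, htan] with z hz hzt v i hi
      rw [← hΘe, ← hz v]
      exact hzt v i hi)
  have hcase : DivPairAt X ω ∨ (ω 0 ≠ 0 ∧ rkAt X 0 = 2) := by
    by_cases ha0 : a 0 = 0
    · by_cases hb0 : b 0 = 0
      · right
        obtain ⟨hl, hr⟩ := aux_rank hY hZ ha hb hX ha0 hb0 hrk
        refine ⟨fun hω0 => ?_, hr⟩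
        obtain ⟨v, hv⟩ := aux_complete2 hl
        have h1 := hω.self_of_nhds v
        rw [hω0, hΘe] at h1
        exact mul_ne_zero hh0 hv h1.symm
      · left
        refine ⟨Y, fun z => (-(b z)⁻¹) • Θ z, hY, fun v => ?_, ?_⟩
        · exact ((hb.inv hb0).neg).mul (hΘ v)
        · filter_upwards [hω, hX, hb.continuousAt.eventually_ne hb0] with z h1 h2 h3 v
          rw [h1 v, AlternatingMap.smul_apply, h2, add_comm (a z • Y z), aux_alt_comb,
            aux_alt_swap (Θ z) (Z z), smul_eq_mul]
          field_simp
    · left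
      refine ⟨Z, fun z => (a z)⁻¹ • Θ z, hZ, fun v => ?_, ?_⟩
      · exact (ha.inv ha0).mul (hΘ v)
      · filter_upwards [hω, hX, ha.continuousAt.eventually_ne ha0] with z h1 h2 h3 v
        rw [h1 v, AlternatingMap.smul_apply, h2, aux_alt_comb, smul_eq_mul]
        field_simp
  have hsing : DivPairAt X ω → ∃ U ∈ 𝓝 (0 : Cn (m + 2)), ∀ z ∈ U, X z = 0 → ω z = 0 := by
    rintro ⟨Y', Θ', -, -, hω'⟩
    refine ⟨_, hω', fun z hz hXz => ?_⟩
    ext v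
    have h1 : ω z v = _ := hz v
    rw [h1, hXz]
    exact (Θ' z).map_coord_zero (0 : Fin (m + 2)) rfl
  have hzero : (∃ U ∈ 𝓝 (0 : Cn (m + 2)), ∀ z ∈ U, X z = 0 → ω z = 0) → ω 0 = 0 := by
    rintro ⟨V, hV, hV0⟩
    exact hV0 0 (mem_of_mem_nhds hV) hX0
  refine ⟨hcase.imp id fun h => h.1, fun hc => hc.2 (hzero (hsing hc.1)), ⟨hsing, fun hs => ?_⟩,
    fun hne => ?_⟩
  · exact hcase.resolve_right fun hc => hc.1 (hzero hs)
  · exact (hcase.resolve_left fun hd => hne (hzero (hsing hd))).2
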